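/- arXiv:2009.08767 — 6 statements merged into one kernel-verified Lean document; each statement's English description precedes it below -/
import Mathlib

section
/- Let k ≥ 1 and n₁, …, n_k ≥ 1 be integers, and let P(n₁,…,n_k) be the group with presentation ⟨a, q₁, …, q_k | q₁^{n₁} = ⋯ = q_k^{n_k} = 1, q₁ q₂ ⋯ q_k a² = 1⟩. Then P(n₁,…,n_k) is finite if and only if at most one of the n_i is greater than 1. -/
/-- The affine group of the complex line: `⟨α, β⟩` stands for `z ↦ α z + β`. -/
@[ext] structure AffC where
  al : ℂˣ
  be : ℂ

namespace AffC

instance : Mul AffC := ⟨fun f g => ⟨f.al * g.al, f.al * g.be + f.be⟩⟩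
instance : One AffC := ⟨⟨1, 0⟩⟩
instance : Inv AffC := ⟨fun f => ⟨f.al⁻¹, -((f.al⁻¹ : ℂˣ) : ℂ) * f.be⟩⟩

@[simp] lemma mul_al (f g : AffC) : (f * g).al = f.al * g.al := rfl
@[simp] lemma mul_be (f g : AffC) : (f * g).be = f.al * g.be + f.be := rfl
@[simp] lemma one_al : (1 : AffC).al = 1 := rfl
@[simp] lemma one_be : (1 : AffC).be = 0 := rfl
@[simp] lemma inv_al (f : AffC) : (f⁻¹).al = f.al⁻¹ := rfl
@[simp] lemma inv_be (f : AffC) : (f⁻¹).be = -((f.al⁻¹ : ℂˣ) : ℂ) * f.be := rfl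

instance : Group AffC := Group.ofLeftAxioms
  (by intro f g h; ext <;> simp <;> ring)
  (by intro f; ext <;> simp)
  (by intro f; ext <;> simp)

/-- Every affine map of the complex line is a square. -/
lemma exists_sq (f : AffC) : ∃ g : AffC, g ^ 2 = f := by
  obtain ⟨s, hs, hs1⟩ : ∃ s : ℂ, s ^ 2 = f.al ∧ s + 1 ≠ 0 := by
    by_cases h : f.al = 1
    · exact ⟨1, by simp [h], by norm_num⟩
    · obtain ⟨s, hs⟩ := IsAlgClosed.exists_pow_nat_eq (f.al : ℂ) (n := 2) (by norm_num)
      refine ⟨s, hs, fun h1 => h ?_⟩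
      have : s = -1 := by linear_combination h1
      ext
      rw [← hs, this]; simp
  have hs0 : s ≠ 0 := by
    rintro rfl
    exact f.al.ne_zero (by rw [← hs]; simp)
  refine ⟨⟨Units.mk0 s hs0, f.be / (s + 1)⟩, ?_⟩
  rw [pow_two]
  ext
  · simp [← hs, pow_two]
  · simp; field_simp

/-- Rotations about a point `p`. -/
lemma rot_pow (u : ℂˣ) (p : ℂ) (m : ℕ) :
    (⟨u, (1 - u) * p⟩ : AffC) ^ m = ⟨u ^ m, (1 - (u : ℂ) ^ m) * p⟩ := by
  induction m with
  | zero => ext <;> simp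
  | succ m ih =>
    rw [pow_succ, ih]
    ext
    · simp [pow_succ]
    · simp; ring

lemma trans_pow (t : ℂ) (m : ℕ) : (⟨1, t⟩ : AffC) ^ m = ⟨1, m * t⟩ := by
  induction m with
  | zero => ext <;> simp
  | succ m ih =>
    rw [pow_succ, ih]
    ext
    · simp
    · simp; ring

end AffC

lemma exists_unit_root (m : ℕ) (hm : 1 < m) : ∃ u : ℂˣ, u ^ m = 1 ∧ (u : ℂ) ≠ 1 := by
  have h := Complex.isPrimitiveRoot_exp m (by omega)
  refine ⟨Units.mk0 _ (h.ne_zero (by omega)), ?_, ?_⟩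
  · ext; simpa using h.pow_eq_one
  · simpa using h.ne_one hm

lemma ofFn_prod_single {G : Type*} [Group G] : ∀ {k : ℕ} (f : Fin k → G) (i : Fin k),
    (∀ l, l ≠ i → f l = 1) → (List.ofFn f).prod = f i := by
  intro k
  induction k with
  | zero => intro f i; exact i.elim0
  | succ k ih =>
    intro f i h
    rw [List.ofFn_succ, List.prod_cons]
    induction i using Fin.cases with
    | zero =>
      have : (fun l : Fin k => f l.succ) = fun _ => 1 := by
        funext l; exact h _ (Fin.succ_ne_zero l)
      simp [this]
    | succ i =>
      rw [h 0 (Fin.succ_ne_zero i).symm, one_mul]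
      exact ih (fun l => f l.succ) i (fun l hl => h _ (by simpa using hl))


/-- The orbifold fundamental group of ℝP²(n₁,…,n_k): generators `a = FreeGroup.of none`
and `qᵢ = FreeGroup.of (some i)` for `i : Fin k`, relators `qᵢ^{nᵢ}` and `q₁ ⋯ q_k a²`.
It is finite if and only if at most one of the `nᵢ` is greater than 1. -/
theorem rp2_orbifold_group_finite_iff (k : ℕ) (hk : 1 ≤ k) (n : Fin k → ℕ)
    (hn : ∀ i, 1 ≤ n i) :
    Finite
      (PresentedGroup
        ((Set.range fun i : Fin k =>
            (FreeGroup.of (some i) : FreeGroup (Option (Fin k))) ^ (n i)) ∪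
          {(List.ofFn fun i : Fin k =>
              (FreeGroup.of (some i) : FreeGroup (Option (Fin k)))).prod *
            (FreeGroup.of none) ^ 2})) ↔
    ∀ i j : Fin k, 1 < n i → 1 < n j → i = j := by

  set rels : Set (FreeGroup (Option (Fin k))) := _ ∪ _ with hrels
  constructor
  · intro hfin i j hi hj
    by_contra hij
    obtain ⟨u, hu, hu1⟩ := exists_unit_root (n i) hi
    obtain ⟨v, hv, hv1⟩ := exists_unit_root (n j) hj
    let x : AffC := ⟨u, (1 - u) * 0⟩
    let y : AffC := ⟨v, (1 - v) * 1⟩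
    have hx : x ^ n i = 1 := by
      simp only [x]; rw [AffC.rot_pow]; ext <;> simp [hu]
    have hy : y ^ n j = 1 := by
      have hv' : (v : ℂ) ^ n j = 1 := by simpa using congrArg Units.val hv
      simp only [y]; rw [AffC.rot_pow]; ext <;> simp [hv, hv']
    let q : Fin k → AffC := fun l => if l = i then x else if l = j then y else 1
    obtain ⟨b, hb⟩ := AffC.exists_sq (List.ofFn q).prod⁻¹
    let F : Option (Fin k) → AffC := fun o => o.elim b q
    have hF : ∀ r ∈ rels, FreeGroup.lift F r = 1 := by
      rintro r (⟨l, rfl⟩ | hr)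
      · simp only [map_pow, FreeGroup.lift_apply_of, F, Option.elim, q]
        split_ifs with h1 h2
        · rw [h1, hx]
        · rw [h2, hy]
        · simp
      · rw [Set.mem_singleton_iff] at hr
        subst hr
        rw [map_mul, map_pow, map_list_prod, List.map_ofFn]
        have : (⇑(FreeGroup.lift F) ∘ fun i : Fin k => FreeGroup.of (some i)) = q := by
          funext l; simp [F]
        rw [this, FreeGroup.lift_apply_of]
        simp only [F, Option.elim]
        rw [hb]; simp
    let φ : PresentedGroup rels →* AffC := PresentedGroup.toGroup hF
    have hφi : φ (PresentedGroup.of (some i)) = x := by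
      simp [φ, F, q]
    have hφj : φ (PresentedGroup.of (some j)) = y := by
      simp [φ, F, q, Ne.symm hij]
    let c : PresentedGroup rels :=
      PresentedGroup.of (some i) * PresentedGroup.of (some j) *
        (PresentedGroup.of (some i))⁻¹ * (PresentedGroup.of (some j))⁻¹
    have hc : φ c = ⟨1, (u - 1) * (1 - v)⟩ := by
      simp only [c]
      rw [map_mul, map_mul, map_mul, map_inv, map_inv, hφi, hφj]
      ext
      · simp [x, y]
      · simp [x, y]; ring
    obtain ⟨N, hN, hcN⟩ := (isOfFinOrder_of_finite c).exists_pow_eq_one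
    have h := congrArg φ hcN
    rw [map_pow, hc, map_one, AffC.trans_pow] at h
    have h2 := congrArg AffC.be h
    simp only [AffC.one_be, mul_eq_zero, sub_eq_zero, Nat.cast_eq_zero] at h2
    rcases h2 with h2 | h2 | h2
    · omega
    · exact hu1 h2
    · exact hv1 h2.symm
  · intro h
    obtain ⟨i, hi⟩ : ∃ i : Fin k, ∀ l, l ≠ i → n l = 1 := by
      by_cases hex : ∃ i, 1 < n i
      · obtain ⟨i, hi⟩ := hex
        refine ⟨i, fun l hl => ?_⟩
        by_contra hne
        exact hl (h l i (by have := hn l; omega) hi)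
      · push Not at hex
        exact ⟨⟨0, hk⟩, fun l _ => le_antisymm (hex l) (hn l)⟩
    let a : PresentedGroup rels := PresentedGroup.of none
    let q : Fin k → PresentedGroup rels := fun l => PresentedGroup.of (some l)
    have hq : ∀ l, q l ^ n l = 1 := by
      intro l
      exact PresentedGroup.one_of_mem (rels := rels) (Or.inl ⟨l, rfl⟩)
    have hprod : (List.ofFn q).prod * a ^ 2 = 1 := by
      have := PresentedGroup.one_of_mem (rels := rels) (Or.inr rfl)
      rw [map_mul, map_pow, map_list_prod, List.map_ofFn] at this
      exact this
    have hq1 : ∀ l, l ≠ i → q l = 1 := by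
      intro l hl
      have := hq l
      rwa [hi l hl, pow_one] at this
    rw [ofFn_prod_single q i hq1] at hprod
    have hqi : q i = (a ^ 2)⁻¹ := eq_inv_of_mul_eq_one_left hprod
    have ha : a ^ (2 * n i) = 1 := by
      have := hq i
      rwa [hqi, inv_pow, inv_eq_one, ← pow_mul] at this
    have htop : Subgroup.zpowers a = ⊤ := by
      rw [eq_top_iff, ← PresentedGroup.closure_range_of rels, Subgroup.closure_le]
      rintro _ ⟨o, rfl⟩
      cases o with
      | none => exact Subgroup.mem_zpowers a
      | some l =>
        change q l ∈ Subgroup.zpowers a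
        by_cases hl : l = i
        · rw [hl, hqi]
          exact inv_mem (pow_mem (Subgroup.mem_zpowers a) 2)
        · rw [hq1 l hl]; exact one_mem _
    have hfo : IsOfFinOrder a :=
      isOfFinOrder_iff_pow_eq_one.2 ⟨2 * n i, by have := hn i; omega, ha⟩
    have hf : (Subgroup.zpowers a : Set (PresentedGroup rels)).Finite := finite_zpowers.2 hfo
    rw [htop, Subgroup.coe_top] at hf
    exact Set.finite_univ_iff.1 hf
end

section
/- Let n₁, n₂ ≥ 2 be integers. Then the group with presentation ⟨a, q₁, q₂ | q₁^{n₁} = 1, q₂^{n₂} = 1, q₁ q₂ a² = 1⟩ is infinite. -/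
/-- The affine permutation `z ↦ u z + c` of `ℂ`. -/
noncomputable def affPerm (u : ℂˣ) (c : ℂ) : Equiv.Perm ℂ where
  toFun z := u * z + c
  invFun z := (u⁻¹ : ℂˣ) * (z - c)
  left_inv z := by simp
  right_inv z := by simp

theorem affPerm_mul (u v : ℂˣ) (c d : ℂ) :
    affPerm u c * affPerm v d = affPerm (u * v) (u * d + c) := by
  ext z
  simp [affPerm]
  ring

theorem affPerm_one : affPerm 1 0 = 1 := by
  ext z
  simp [affPerm]

theorem affPerm_fix_pow (u : ℂˣ) (p : ℂ) (n : ℕ) :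
    affPerm u (p - u * p) ^ n = affPerm (u ^ n) (p - (u ^ n : ℂˣ) * p) := by
  induction n with
  | zero => simp [affPerm_one]
  | succ n ih =>
    rw [pow_succ, ih, affPerm_mul, pow_succ]
    congr 1
    push_cast
    ring

theorem affPerm_trans_pow (c : ℂ) (n : ℕ) : affPerm 1 c ^ n = affPerm 1 (n * c) := by
  induction n with
  | zero => simp [affPerm_one]
  | succ n ih =>
    rw [pow_succ, ih, affPerm_mul]
    congr 1
    · simp
    · push_cast
      ring

theorem exists_root_unit (n : ℕ) (h : 2 ≤ n) : ∃ u : ℂˣ, u ^ n = 1 ∧ (u : ℂ) ≠ 1 := by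
  have hp := Complex.isPrimitiveRoot_exp n (by omega)
  obtain ⟨u, hu⟩ := hp.isUnit (by omega)
  refine ⟨u, ?_, ?_⟩
  · ext
    push_cast
    rw [hu]
    exact hp.pow_eq_one
  · rw [hu]
    exact hp.ne_one (by omega)

theorem exists_sqrt_unit (w : ℂˣ) : ∃ u : ℂˣ, u * u = w ∧ (u : ℂ) + 1 ≠ 0 := by
  obtain ⟨m, hm⟩ := IsAlgClosed.exists_pow_nat_eq (w : ℂ) (n := 2) (by norm_num)
  have hm0 : m ≠ 0 := by
    rintro rfl
    exact w.ne_zero (by rw [← hm]; norm_num)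
  by_cases h : m + 1 = 0
  · refine ⟨1, ?_, by norm_num⟩
    ext
    have : m = -1 := by linear_combination h
    rw [← hm, this]
    norm_num
  · refine ⟨Units.mk0 m hm0, ?_, h⟩
    ext
    rw [← hm]
    simp [sq]

/-- The orbifold fundamental group of ℝP²(n₁,n₂), n₁,n₂ ≥ 2, is infinite.
Generators: `a = FreeGroup.of 0`, `q₁ = FreeGroup.of 1`, `q₂ = FreeGroup.of 2`;
relators `q₁^{n₁}`, `q₂^{n₂}`, `q₁ q₂ a²`. -/
theorem rp2_two_cone_points_infinite (n₁ n₂ : ℕ) (h₁ : 2 ≤ n₁) (h₂ : 2 ≤ n₂) :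
    Infinite
      (PresentedGroup
        ({(FreeGroup.of 1) ^ n₁, (FreeGroup.of 2) ^ n₂,
          FreeGroup.of 1 * FreeGroup.of 2 * (FreeGroup.of 0) ^ 2} :
            Set (FreeGroup (Fin 3)))) := by
  obtain ⟨u, hu, hu1⟩ := exists_root_unit n₁ h₁
  obtain ⟨v, hv, hv1⟩ := exists_root_unit n₂ h₂
  obtain ⟨m, hm, hm1⟩ := exists_sqrt_unit (u * v)
  obtain ⟨x, hx⟩ : ∃ x, x = affPerm u (0 - u * 0) := ⟨_, rfl⟩
  obtain ⟨y, hy⟩ : ∃ y, y = affPerm v (1 - v * 1) := ⟨_, rfl⟩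
  obtain ⟨b, hb⟩ : ∃ b, b = affPerm m (u * (1 - v) / (m + 1)) := ⟨_, rfl⟩
  have hxn : x ^ n₁ = 1 := by
    rw [hx, affPerm_fix_pow, hu]
    simp [affPerm_one]
  have hyn : y ^ n₂ = 1 := by
    rw [hy, affPerm_fix_pow, hv]
    simp [affPerm_one]
  have hbb : x * y = b * b := by
    rw [hx, hy, hb, affPerm_mul, affPerm_mul, hm]
    congr 1
    field_simp
    ring
  have hcomm : x * y = affPerm 1 ((u - 1) * (1 - v)) * (y * x) := by
    rw [hx, hy, affPerm_mul, affPerm_mul, affPerm_mul]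
    congr 1
    · rw [one_mul, mul_comm]
    · push_cast
      ring
  let f : Fin 3 → Equiv.Perm ℂ := ![b⁻¹, x, y]
  have hf : ∀ r ∈ ({(FreeGroup.of 1) ^ n₁, (FreeGroup.of 2) ^ n₂,
          FreeGroup.of 1 * FreeGroup.of 2 * (FreeGroup.of 0) ^ 2} :
            Set (FreeGroup (Fin 3))), FreeGroup.lift f r = 1 := by
    rintro r (rfl | rfl | rfl)
    · simp [f, hxn]
    · simp [f, hyn]
    · simp only [map_mul, map_pow, FreeGroup.lift_apply_of]
      change x * y * b⁻¹ ^ 2 = 1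
      rw [hbb]
      group
  by_contra hfin
  rw [not_infinite_iff_finite] at hfin
  let F := PresentedGroup.toGroup hf
  let X : PresentedGroup ({(FreeGroup.of 1) ^ n₁, (FreeGroup.of 2) ^ n₂,
          FreeGroup.of 1 * FreeGroup.of 2 * (FreeGroup.of 0) ^ 2} :
            Set (FreeGroup (Fin 3))) := PresentedGroup.of 1
  let Y : PresentedGroup ({(FreeGroup.of 1) ^ n₁, (FreeGroup.of 2) ^ n₂,
          FreeGroup.of 1 * FreeGroup.of 2 * (FreeGroup.of 0) ^ 2} :
            Set (FreeGroup (Fin 3))) := PresentedGroup.of 2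
  have hX : F X = x := PresentedGroup.toGroup.of hf
  have hY : F Y = y := PresentedGroup.toGroup.of hf
  obtain ⟨n, hn, hpow⟩ := (isOfFinOrder_of_finite (X * Y * (Y * X)⁻¹)).exists_pow_eq_one
  have h := congrArg F hpow
  rw [map_pow, map_mul, map_inv, map_mul, map_mul, map_one, hX, hY, hcomm,
    mul_inv_cancel_right, affPerm_trans_pow] at h
  have h0 := congrArg (fun g : Equiv.Perm ℂ => g 0) h
  simp [affPerm, sub_eq_zero, hu1, hn.ne', hv1.symm] at h0
end

section
/- Let n ≥ 1 and β ≥ 1 be integers, and let G(n,β) be the group with presentation ⟨a, h | a⁻¹ h a = h⁻¹, a^{2n} = h^β⟩. Then the cyclic subgroup ⟨h⟩ generated by h is a normal subgroup of G(n,β) of order exactly 2β, and the quotient group G(n,β)/⟨h⟩ is cyclic of order 2n, generated by the image of a. In particular, G(n,β) is a metacyclic group ℤ_{2β} ↣ G(n,β) ↠ ℤ_{2n}. -/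
/-- Relators of `G(n,β) = ⟨a, h | a⁻¹ha = h⁻¹, a^{2n} = h^β⟩`, with
`a = FreeGroup.of 0` and `h = FreeGroup.of 1`. -/
def Grels (n β : ℕ) : Set (FreeGroup (Fin 2)) :=
  {(FreeGroup.of 0)⁻¹ * FreeGroup.of 1 * FreeGroup.of 0 * FreeGroup.of 1,
   (FreeGroup.of 0) ^ (2 * n) * ((FreeGroup.of 1) ^ β)⁻¹}

/-- The matrix `diag(z, z⁻¹)` as a unit. -/
noncomputable def Hmat (z : ℂ) (hz : z ≠ 0) : (Matrix (Fin 2) (Fin 2) ℂ)ˣ where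
  val := Matrix.diagonal ![z, z⁻¹]
  inv := Matrix.diagonal ![z⁻¹, z]
  val_inv := by
    ext i j; fin_cases i <;> fin_cases j <;> simp [hz]
  inv_val := by
    ext i j; fin_cases i <;> fin_cases j <;> simp [hz]

/-- The antidiagonal matrix with entries `1, d`. -/
noncomputable def Amat (d : ℂ) (hd : d ≠ 0) : (Matrix (Fin 2) (Fin 2) ℂ)ˣ where
  val := !![0, 1; d, 0]
  inv := !![0, d⁻¹; 1, 0]
  val_inv := by
    ext i j; fin_cases i <;> fin_cases j <;> simp [hd]
  inv_val := by
    ext i j; fin_cases i <;> fin_cases j <;> simp [hd]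

lemma Hmat_pow (z : ℂ) (hz : z ≠ 0) (k : ℕ) :
    ((Hmat z hz ^ k : (Matrix (Fin 2) (Fin 2) ℂ)ˣ) : Matrix (Fin 2) (Fin 2) ℂ) =
      Matrix.diagonal ![z ^ k, (z ^ k)⁻¹] := by
  rw [Units.val_pow_eq_pow_val]
  change (Matrix.diagonal ![z, z⁻¹]) ^ k = _
  rw [Matrix.diagonal_pow]
  congr 1
  ext i; fin_cases i <;> simp

lemma Amat_pow (d : ℂ) (hd : d ≠ 0) (k : ℕ) :
    ((Amat d hd ^ (2 * k) : (Matrix (Fin 2) (Fin 2) ℂ)ˣ) : Matrix (Fin 2) (Fin 2) ℂ) =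
      Matrix.diagonal ![d ^ k, d ^ k] := by
  rw [Units.val_pow_eq_pow_val, pow_mul]
  have : ((Amat d hd : (Matrix (Fin 2) (Fin 2) ℂ)ˣ) : Matrix (Fin 2) (Fin 2) ℂ) ^ 2 =
      Matrix.diagonal ![d, d] := by
    rw [pow_two]
    change !![0, 1; d, 0] * !![0, 1; d, 0] = _
    ext i j; fin_cases i <;> fin_cases j <;> simp
  rw [this, Matrix.diagonal_pow]
  congr 1
  ext i; fin_cases i <;> simp

lemma AH_conj (z d : ℂ) (hz : z ≠ 0) (hd : d ≠ 0) :
    (Amat d hd)⁻¹ * Hmat z hz * Amat d hd * Hmat z hz = 1 := by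
  ext i j
  change (!![0, d⁻¹; 1, 0] * Matrix.diagonal ![z, z⁻¹] * !![0, 1; d, 0] *
    Matrix.diagonal ![z, z⁻¹] : Matrix (Fin 2) (Fin 2) ℂ) i j =
    (1 : Matrix (Fin 2) (Fin 2) ℂ) i j
  have hD : (Matrix.diagonal ![z, z⁻¹] : Matrix (Fin 2) (Fin 2) ℂ) = !![z, 0; 0, z⁻¹] := by
    ext i j; fin_cases i <;> fin_cases j <;> simp
  rw [hD, Matrix.mul_fin_two, Matrix.mul_fin_two, Matrix.mul_fin_two]
  fin_cases i <;> fin_cases j <;> simp <;> field_simp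

lemma exists_prim (m : ℕ) (hm : 1 ≤ m) :
    ∃ z : ℂ, z ≠ 0 ∧ z ^ m = -1 ∧ IsPrimitiveRoot z (2 * m) := by
  have hp := Complex.isPrimitiveRoot_exp (2 * m) (by omega)
  refine ⟨_, Complex.exp_ne_zero _, ?_, hp⟩
  have h2 : IsPrimitiveRoot _ 2 := hp.pow (by omega) (show 2 * m = m * 2 by ring)
  exact h2.eq_neg_one_of_two_right

lemma Grel_conj (n β : ℕ) :
    (PresentedGroup.of 0 : PresentedGroup (Grels n β))⁻¹ * PresentedGroup.of 1 *
      PresentedGroup.of 0 = (PresentedGroup.of 1)⁻¹ := by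
  rw [eq_inv_iff_mul_eq_one]
  exact PresentedGroup.one_of_mem (rels := Grels n β) (Or.inl rfl)

lemma Grel_pow (n β : ℕ) :
    (PresentedGroup.of 0 : PresentedGroup (Grels n β)) ^ (2 * n) =
      (PresentedGroup.of 1) ^ β := by
  rw [← mul_inv_eq_one]
  exact PresentedGroup.one_of_mem (rels := Grels n β) (Or.inr rfl)

lemma conj_zpow_aux {G : Type*} [Group G] {a h : G} (H : a⁻¹ * h * a = h⁻¹) (k : ℤ) :
    a⁻¹ * h ^ k * a = h ^ (-k) := by
  have := conj_zpow (i := k) (a := a⁻¹) (b := h)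
  rw [inv_inv, H] at this
  rw [← this]; simp

lemma conj_zpow_aux' {G : Type*} [Group G] {a h : G} (H : a⁻¹ * h * a = h⁻¹) (k : ℤ) :
    a * h ^ k * a⁻¹ = h ^ (-k) := by
  have := conj_zpow_aux H (-k)
  rw [neg_neg] at this
  rw [← this]; group

lemma G_normal (n β : ℕ) :
    (Subgroup.zpowers (PresentedGroup.of 1 : PresentedGroup (Grels n β))).Normal := by
  rw [← Subgroup.normalizer_eq_top_iff, eq_top_iff,
    ← PresentedGroup.closure_range_of (Grels n β), Subgroup.closure_le]
  rintro _ ⟨i, rfl⟩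
  fin_cases i
  · change PresentedGroup.of 0 ∈ _
    rw [SetLike.mem_coe, Subgroup.mem_normalizer_iff]
    intro x
    constructor
    · rintro ⟨k, rfl⟩
      exact ⟨-k, (conj_zpow_aux' (Grel_conj n β) k).symm⟩
    · rintro ⟨k, hk⟩
      refine ⟨-k, ?_⟩
      change _ ^ (-k) = _
      rw [← conj_zpow_aux (Grel_conj n β) k]
      change _ ^ k = _ at hk
      rw [hk]; group
  · exact Subgroup.le_normalizer (Subgroup.mem_zpowers _)

lemma G_order (n β : ℕ) (hn : 1 ≤ n) (hβ : 1 ≤ β) :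
    orderOf (PresentedGroup.of 1 : PresentedGroup (Grels n β)) = 2 * β := by
  apply Nat.dvd_antisymm
  · apply orderOf_dvd_of_pow_eq_one
    have h1 := conj_zpow_aux (Grel_conj n β) β
    rw [zpow_neg, zpow_natCast, ← Grel_pow] at h1
    have h2 : (PresentedGroup.of 0 : PresentedGroup (Grels n β))⁻¹ *
        PresentedGroup.of 0 ^ (2 * n) * PresentedGroup.of 0 =
        PresentedGroup.of 0 ^ (2 * n) := by
      rw [mul_assoc, ← pow_succ, pow_succ', inv_mul_cancel_left]
    rw [h2, eq_inv_iff_mul_eq_one, Grel_pow, ← pow_add] at h1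
    rw [two_mul]; exact h1
  · obtain ⟨z, hz, hzβ, hprim⟩ := exists_prim β hβ
    obtain ⟨d, hd, hdn, -⟩ := exists_prim n hn
    have hrel : ∀ r ∈ Grels n β, FreeGroup.lift ![Amat d hd, Hmat z hz] r = 1 := by
      rintro r (rfl | rfl)
      · simpa using AH_conj z d hz hd
      · simp only [map_mul, map_inv, map_pow, FreeGroup.lift_apply_of]
        rw [mul_inv_eq_one]
        apply Units.ext
        change ((Amat d hd ^ (2 * n) : (Matrix (Fin 2) (Fin 2) ℂ)ˣ) :
          Matrix (Fin 2) (Fin 2) ℂ) = ((Hmat z hz ^ β : (Matrix (Fin 2) (Fin 2) ℂ)ˣ) : _)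
        rw [Amat_pow, Hmat_pow, hzβ, hdn]
        norm_num
    let f := PresentedGroup.toGroup hrel
    have hf : f (PresentedGroup.of 1) = Hmat z hz := by
      simp [f, PresentedGroup.toGroup.of]
    apply hprim.dvd_of_pow_eq_one
    have h3 : Hmat z hz ^ orderOf (PresentedGroup.of 1 : PresentedGroup (Grels n β)) = 1 := by
      rw [← hf, ← map_pow, pow_orderOf_eq_one, map_one]
    have h4 := congrArg (fun u : (Matrix (Fin 2) (Fin 2) ℂ)ˣ =>
      (u : Matrix (Fin 2) (Fin 2) ℂ) 0 0) h3
    simp only [Hmat_pow] at h4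
    simpa using h4

/-- `G(n,β)` is metacyclic: the cyclic subgroup `⟨h⟩` is normal of order exactly `2β`,
and the quotient is cyclic of order `2n`, generated by the image of `a`.  The quotient
is expressed via a surjective homomorphism onto `ℤ_{2n}` with kernel `⟨h⟩` sending `a`
to a generator. -/
theorem G_metacyclic (n β : ℕ) (hn : 1 ≤ n) (hβ : 1 ≤ β) :
    (Subgroup.zpowers (PresentedGroup.of 1 : PresentedGroup (Grels n β))).Normal ∧
    Nat.card (Subgroup.zpowers (PresentedGroup.of 1 : PresentedGroup (Grels n β))) =
      2 * β ∧
    ∃ φ : PresentedGroup (Grels n β) →* Multiplicative (ZMod (2 * n)),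
      Function.Surjective φ ∧
      φ.ker = Subgroup.zpowers (PresentedGroup.of 1) ∧
      φ (PresentedGroup.of 0) = Multiplicative.ofAdd 1 := by
  have hN := G_normal n β
  refine ⟨hN, ?_, ?_⟩
  · rw [Nat.card_zpowers, G_order n β hn hβ]
  have hrel : ∀ r ∈ Grels n β,
      FreeGroup.lift ![(Multiplicative.ofAdd 1 : Multiplicative (ZMod (2 * n))), 1] r = 1 := by
    rintro r (rfl | rfl)
    · simp
    · simp only [map_mul, map_inv, map_pow, FreeGroup.lift_apply_of]
      simp only [Matrix.cons_val_zero, Matrix.cons_val_one, one_pow, inv_one, mul_one]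
      rw [← ofAdd_nsmul, nsmul_one, ZMod.natCast_self, ofAdd_zero]
  let φ := PresentedGroup.toGroup hrel
  have h0 : φ (PresentedGroup.of 0) = Multiplicative.ofAdd 1 := by
    simp [φ, PresentedGroup.toGroup.of]
  have h1 : φ (PresentedGroup.of 1) = 1 := by
    simp [φ, PresentedGroup.toGroup.of]
  refine ⟨φ, ?_, ?_, h0⟩
  · intro y
    obtain ⟨k, hk⟩ := ZMod.intCast_surjective (Multiplicative.toAdd y)
    refine ⟨PresentedGroup.of 0 ^ k, ?_⟩
    rw [map_zpow, h0, ← ofAdd_zsmul, zsmul_one, hk, ofAdd_toAdd]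
  · apply le_antisymm
    · intro g hg
      rw [MonoidHom.mem_ker] at hg
      let N := Subgroup.zpowers (PresentedGroup.of 1 : PresentedGroup (Grels n β))
      have key : ∀ g : PresentedGroup (Grels n β),
          g ∈ (Subgroup.zpowers (QuotientGroup.mk' N (PresentedGroup.of 0))).comap
            (QuotientGroup.mk' N) := by
        intro g
        have hg : g ∈ Subgroup.closure (Set.range
            (PresentedGroup.of : Fin 2 → PresentedGroup (Grels n β))) := by
          rw [PresentedGroup.closure_range_of]; trivial
        refine (Subgroup.closure_le _).2 ?_ hg
        rintro _ ⟨i, rfl⟩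
        fin_cases i
        · exact Subgroup.mem_zpowers _
        · change QuotientGroup.mk' N (PresentedGroup.of 1) ∈
            Subgroup.zpowers (QuotientGroup.mk' N (PresentedGroup.of 0))
          have : QuotientGroup.mk' N (PresentedGroup.of 1) = 1 :=
            (QuotientGroup.eq_one_iff _).2 (Subgroup.mem_zpowers _)
          rw [this]; exact one_mem _
      obtain ⟨k, hk⟩ := key g
      change _ ^ k = _ at hk
      rw [← map_zpow] at hk
      have hk' : (PresentedGroup.of 0 ^ k)⁻¹ * g ∈ N := QuotientGroup.eq.1 hk
      have hle : N ≤ φ.ker := by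
        rw [Subgroup.zpowers_le]; exact h1
      have h5 : φ ((PresentedGroup.of 0 ^ k)⁻¹ * g) = 1 := hle hk'
      rw [map_mul, hg, mul_one, map_inv, inv_eq_one, map_zpow, h0, ← ofAdd_zsmul, zsmul_one,
        ofAdd_eq_one, ZMod.intCast_zmod_eq_zero_iff_dvd] at h5
      obtain ⟨m, rfl⟩ := h5
      have h6 : (PresentedGroup.of 0 : PresentedGroup (Grels n β)) ^ (((2 * n : ℕ) : ℤ) * m) ∈ N := by
        rw [zpow_mul, zpow_natCast, Grel_pow]
        exact zpow_mem (pow_mem (Subgroup.mem_zpowers _) _) _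
      have := mul_mem h6 hk'
      rwa [mul_inv_cancel_left] at this
    · rw [Subgroup.zpowers_le]; exact h1
end

section
/- Let n ≥ 1 and β ≥ 1 be integers, and let G(n,β) be the group with presentation ⟨a, h | a⁻¹ h a = h⁻¹, a^{2n} = h^β⟩. Then every element of G(n,β) can be written uniquely in the form a^k h^ℓ with 0 ≤ k ≤ 2n−1 and 0 ≤ ℓ ≤ 2β−1; that is, the map {0,…,2n−1} × {0,…,2β−1} → G(n,β) given by (k,ℓ) ↦ a^k h^ℓ is a bijection. In particular, G(n,β) has order 4nβ. -/
/-- Spanning: in any group with the two relations, products `a^i h^j` can be reduced. -/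
theorem G_aux_span {G : Type*} [Group G] (a h : G) (n β : ℕ) (hn : 1 ≤ n) (hβ : 1 ≤ β)
    (r1 : a⁻¹ * h * a * h = 1) (r2 : a ^ (2 * n) = h ^ β)
    (hcl : Subgroup.closure {a, h} = ⊤) (x : G) :
    ∃ k < 2 * n, ∃ l < 2 * β, a ^ k * h ^ l = x := by
  have s1 : SemiconjBy a h⁻¹ h := by
    have : a⁻¹ * h * a = h⁻¹ := eq_inv_of_mul_eq_one_left r1
    rw [SemiconjBy, ← this]; group
  have s2 : SemiconjBy a h h⁻¹ := by simpa using s1.inv_right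
  have comm : ∀ k j : ℤ, ∃ j' : ℤ, h ^ j * a ^ k = a ^ k * h ^ j' := by
    intro k
    induction k with
    | zero => intro j; exact ⟨j, by simp⟩
    | succ k ih =>
      intro j
      obtain ⟨j', hj⟩ := ih j
      refine ⟨-j', ?_⟩
      have := (s1.zpow_right j').eq
      rw [inv_zpow'] at this
      rw [zpow_add_one, ← mul_assoc, hj, mul_assoc, ← this, mul_assoc]
    | pred k ih =>
      intro j
      obtain ⟨j', hj⟩ := ih j
      refine ⟨-j', ?_⟩
      have := (s2.inv_symm_left.zpow_right j').eq
      rw [inv_zpow'] at this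
      rw [zpow_sub_one, ← mul_assoc, hj, mul_assoc, ← this, mul_assoc]
  have hh : h ^ (2 * β) = 1 := by
    have e := (s2.pow_right β).eq
    rw [inv_pow, ← r2, ← pow_succ', pow_succ] at e
    have e2 : a ^ (2 * n) = (a ^ (2 * n))⁻¹ := by
      have e3 : a ^ (2 * n) * a = (a ^ (2 * n))⁻¹ * a := e
      exact mul_right_cancel e3
    rw [mul_comm, pow_mul, ← r2, pow_two]
    nth_rewrite 2 [e2]
    simp
  have key : ∃ i j : ℤ, x = a ^ i * h ^ j := by
    have hx : x ∈ Subgroup.closure {a, h} := by rw [hcl]; trivial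
    induction hx using Subgroup.closure_induction with
    | mem x hx =>
      rcases hx with rfl | rfl
      · exact ⟨1, 0, by simp⟩
      · exact ⟨0, 1, by simp⟩
    | one => exact ⟨0, 0, by simp⟩
    | mul x y _ _ hx hy =>
      obtain ⟨i, j, rfl⟩ := hx
      obtain ⟨k, l, rfl⟩ := hy
      obtain ⟨j', hj⟩ := comm k j
      refine ⟨i + k, j' + l, ?_⟩
      rw [zpow_add, zpow_add, mul_assoc, ← mul_assoc (h ^ j), hj]
      simp only [mul_assoc]
    | inv x _ hx =>
      obtain ⟨i, j, rfl⟩ := hx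
      obtain ⟨j', hj⟩ := comm (-i) (-j)
      refine ⟨-i, j', ?_⟩
      rw [← hj]; simp
  obtain ⟨i, j, rfl⟩ := key
  have e1 : a ^ i = a ^ (i % (2 * n : ℕ)) * h ^ (β * (i / (2 * n : ℕ))) := by
    conv_lhs => rw [← Int.emod_add_mul_ediv i (2 * n : ℕ), zpow_add, zpow_mul, zpow_natCast, r2]
    rw [zpow_mul, zpow_natCast]
  rw [e1, mul_assoc, ← zpow_add]
  generalize (β * (i / (2 * n : ℕ)) + j : ℤ) = m
  have e2 : h ^ m = h ^ (m % (2 * β : ℕ)) := by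
    conv_lhs => rw [← Int.emod_add_mul_ediv m (2 * β : ℕ), zpow_add, zpow_mul, zpow_natCast, hh]
    simp
  rw [e2]
  have p1 : 0 ≤ i % (2 * n : ℕ) := Int.emod_nonneg _ (by omega)
  have p2 : 0 ≤ m % (2 * β : ℕ) := Int.emod_nonneg _ (by omega)
  have q1 : i % (2 * n : ℕ) < (2 * n : ℕ) := Int.emod_lt_of_pos _ (by omega)
  have q2 : m % (2 * β : ℕ) < (2 * β : ℕ) := Int.emod_lt_of_pos _ (by omega)
  refine ⟨(i % (2 * n : ℕ)).toNat, by omega, (m % (2 * β : ℕ)).toNat, by omega, ?_⟩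
  rw [← zpow_natCast, ← zpow_natCast, Int.toNat_of_nonneg p1, Int.toNat_of_nonneg p2]

/-- Model of `a`. -/
def GmodelA {M : Type*} [AddCommGroup M] (c : M) : Equiv.Perm (M × M) where
  toFun p := (p.2 + c, p.1 + c)
  invFun p := (p.2 - c, p.1 - c)
  left_inv p := by simp
  right_inv p := by simp

/-- Model of `h`. -/
def GmodelH {M : Type*} [AddCommGroup M] (d : M) : Equiv.Perm (M × M) where
  toFun p := (p.1 + d, p.2 - d)
  invFun p := (p.1 - d, p.2 + d)
  left_inv p := by simp
  right_inv p := by simp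

theorem GmodelH_pow {M : Type*} [AddCommGroup M] (d : M) (k : ℕ) (p : M × M) :
    (GmodelH d ^ k) p = (p.1 + k • d, p.2 - k • d) := by
  induction k with
  | zero => simp
  | succ k ih =>
    rw [pow_succ', Equiv.Perm.mul_apply, ih]
    ext <;> simp [GmodelH, succ_nsmul] <;> abel

theorem GmodelA_pow {M : Type*} [AddCommGroup M] (c : M) (k : ℕ) (p : M × M) :
    (GmodelA c ^ (2 * k)) p = (p.1 + (2 * k) • c, p.2 + (2 * k) • c) := by
  induction k with
  | zero => simp
  | succ k ih =>
    rw [show 2 * (k + 1) = 2 * k + 1 + 1 by ring, pow_succ', pow_succ', Equiv.Perm.mul_apply,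
      Equiv.Perm.mul_apply, ih]
    ext <;> simp [GmodelA, succ_nsmul] <;> abel

theorem GmodelA_pow_sum {M : Type*} [AddCommGroup M] (c : M) (k : ℕ) (p : M × M) :
    ((GmodelA c ^ k) p).1 + ((GmodelA c ^ k) p).2 = p.1 + p.2 + k • (2 • c) := by
  induction k with
  | zero => simp
  | succ k ih =>
    rw [pow_succ', Equiv.Perm.mul_apply, succ_nsmul, ← add_assoc, ← ih]
    simp only [GmodelA, Equiv.coe_fn_mk]; abel

theorem G_aux_inj (n β : ℕ) (hn : 1 ≤ n) (hβ : 1 ≤ β) (k k' l l' : ℕ)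
    (hk : k < 2 * n) (hk' : k' < 2 * n) (hl : l < 2 * β) (hl' : l' < 2 * β)
    (e : (PresentedGroup.of 0 : PresentedGroup (Grels n β)) ^ k * (PresentedGroup.of 1) ^ l =
      (PresentedGroup.of 0 : PresentedGroup (Grels n β)) ^ k' * (PresentedGroup.of 1) ^ l') :
    k = k' ∧ l = l' := by
  let c : ZMod (4 * n * β) := (β : ℕ)
  let d : ZMod (4 * n * β) := (2 * n : ℕ)
  have hz : ((4 * n * β : ℕ) : ZMod (4 * n * β)) = 0 := ZMod.natCast_self _
  have hr : ∀ r ∈ Grels n β, FreeGroup.lift ![GmodelA c, GmodelH d] r = 1 := by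
    rintro r (rfl | rfl)
    · simp only [map_mul, map_inv, FreeGroup.lift_apply_of, Matrix.cons_val_zero,
        Matrix.cons_val_one]
      rw [mul_assoc (_ * _) (GmodelA c), mul_assoc (GmodelA c)⁻¹, inv_mul_eq_one]
      ext p <;> simp [GmodelA, GmodelH] <;> abel
    · simp only [map_mul, map_inv, map_pow, FreeGroup.lift_apply_of, Matrix.cons_val_zero,
        Matrix.cons_val_one]
      rw [mul_inv_eq_one]
      refine Equiv.ext fun p => ?_
      rw [GmodelA_pow, GmodelH_pow]
      push_cast at hz
      ext
      · simp [c, d]; ring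
      · simp [c, d]; linear_combination hz
  have e' := congrArg (PresentedGroup.toGroup hr) e
  simp only [map_mul, map_pow, PresentedGroup.toGroup.of, Matrix.cons_val_zero,
        Matrix.cons_val_one] at e'
  have cast_inj : ∀ u v : ℕ, u < 4 * n * β → v < 4 * n * β →
      ((u : ℕ) : ZMod (4 * n * β)) = v → u = v := by
    intro u v hu hv h
    rw [ZMod.natCast_eq_natCast_iff] at h
    exact Nat.ModEq.eq_of_lt_of_lt h hu hv
  have kk : k = k' := by
    have e0 := congrArg (fun f : Equiv.Perm _ => (f (0, 0)).1 + (f (0, 0)).2) e'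
    simp only [Equiv.Perm.mul_apply, GmodelA_pow_sum, GmodelH_pow] at e0
    have e1 : ((k * (2 * β) : ℕ) : ZMod (4 * n * β)) = (k' * (2 * β) : ℕ) := by
      simpa [c] using e0
    have := cast_inj _ _ (by nlinarith) (by nlinarith) e1
    exact Nat.eq_of_mul_eq_mul_right (by omega) this
  subst kk
  refine ⟨rfl, ?_⟩
  have e2 := mul_left_cancel e'
  have e0 := congrArg (fun f : Equiv.Perm _ => (f (0, 0)).1) e2
  simp only [GmodelH_pow] at e0
  have e1 : ((l * (2 * n) : ℕ) : ZMod (4 * n * β)) = (l' * (2 * n) : ℕ) := by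
    simpa [d] using e0
  have := cast_inj _ _ (by nlinarith) (by nlinarith) e1
  exact Nat.eq_of_mul_eq_mul_right (by omega) this

/-- Every element of `G(n,β)` is uniquely of the form `a^k h^ℓ` with `0 ≤ k ≤ 2n−1`,
`0 ≤ ℓ ≤ 2β−1`; in particular `G(n,β)` has order `4nβ`. -/
theorem G_normal_form (n β : ℕ) (hn : 1 ≤ n) (hβ : 1 ≤ β) :
    Function.Bijective
      (fun p : Fin (2 * n) × Fin (2 * β) =>
        (PresentedGroup.of 0 : PresentedGroup (Grels n β)) ^ (p.1 : ℕ) *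
          (PresentedGroup.of 1) ^ (p.2 : ℕ)) ∧
    Nat.card (PresentedGroup (Grels n β)) = 4 * n * β := by
  have hb : Function.Bijective
      (fun p : Fin (2 * n) × Fin (2 * β) =>
        (PresentedGroup.of 0 : PresentedGroup (Grels n β)) ^ (p.1 : ℕ) *
          (PresentedGroup.of 1) ^ (p.2 : ℕ)) := by
    constructor
    · rintro ⟨k, l⟩ ⟨k', l'⟩ e
      obtain ⟨h1, h2⟩ := G_aux_inj n β hn hβ k k' l l' k.2 k'.2 l.2 l'.2 e
      exact Prod.ext (Fin.ext h1) (Fin.ext h2)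
    · intro x
      have r1 : (PresentedGroup.of 0 : PresentedGroup (Grels n β))⁻¹ * PresentedGroup.of 1 *
          PresentedGroup.of 0 * PresentedGroup.of 1 = 1 :=
        PresentedGroup.one_of_mem (rels := Grels n β) (Or.inl rfl)
      have r2 : (PresentedGroup.of 0 : PresentedGroup (Grels n β)) ^ (2 * n) *
          ((PresentedGroup.of 1) ^ β)⁻¹ = 1 :=
        PresentedGroup.one_of_mem (rels := Grels n β) (Or.inr rfl)
      have hcl : Subgroup.closure {(PresentedGroup.of 0 : PresentedGroup (Grels n β)),
          PresentedGroup.of 1} = ⊤ := by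
        rw [← PresentedGroup.closure_range_of (Grels n β)]
        congr 1
        ext y
        simp [Fin.exists_fin_two, eq_comm]
      obtain ⟨k, hk, l, hl, e⟩ := G_aux_span _ _ n β hn hβ r1 (mul_inv_eq_one.1 r2) hcl x
      exact ⟨(⟨k, hk⟩, ⟨l, hl⟩), e⟩
  refine ⟨hb, ?_⟩
  rw [← Nat.card_congr (Equiv.ofBijective _ hb)]
  simp
  ring
end

section
/- Let n ≥ 1 and β ≥ 2 be integers, and let G(n,β) be the group with presentation ⟨a, h | a⁻¹ h a = h⁻¹, a^{2n} = h^β⟩. Then G(n,β) is not cyclic (indeed not abelian): if a commuted with h then h² = 1, contradicting that h has order 2β ≥ 4. -/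
/-- Diagonal element. -/
noncomputable def hMat (z : ℂ) (hz : z ≠ 0) : (Matrix (Fin 2) (Fin 2) ℂ)ˣ where
  val := !![z, 0; 0, z⁻¹]
  inv := !![z⁻¹, 0; 0, z]
  val_inv := by ext i j; fin_cases i <;> fin_cases j <;> simp [hz]
  inv_val := by ext i j; fin_cases i <;> fin_cases j <;> simp [hz]

/-- Antidiagonal element. -/
noncomputable def aMat (c : ℂ) (hc : c ≠ 0) : (Matrix (Fin 2) (Fin 2) ℂ)ˣ where
  val := !![0, c; c, 0]
  inv := !![0, c⁻¹; c⁻¹, 0]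
  val_inv := by ext i j; fin_cases i <;> fin_cases j <;> simp [hc]
  inv_val := by ext i j; fin_cases i <;> fin_cases j <;> simp [hc]

theorem hMat_pow (z : ℂ) (hz : z ≠ 0) (k : ℕ) :
    ((hMat z hz ^ k : (Matrix (Fin 2) (Fin 2) ℂ)ˣ) : Matrix (Fin 2) (Fin 2) ℂ)
      = !![z ^ k, 0; 0, (z ^ k)⁻¹] := by
  induction k with
  | zero => ext i j; fin_cases i <;> fin_cases j <;> simp
  | succ k ih =>
    rw [pow_succ, Units.val_mul, ih]
    ext i j; fin_cases i <;> fin_cases j <;> simp [hMat, pow_succ, mul_comm]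

theorem aMat_pow (c : ℂ) (hc : c ≠ 0) (k : ℕ) :
    ((aMat c hc ^ (2 * k) : (Matrix (Fin 2) (Fin 2) ℂ)ˣ) : Matrix (Fin 2) (Fin 2) ℂ)
      = !![c ^ (2 * k), 0; 0, c ^ (2 * k)] := by
  induction k with
  | zero => ext i j; fin_cases i <;> fin_cases j <;> simp
  | succ k ih =>
    rw [mul_add, mul_one, pow_add, Units.val_mul, ih]
    ext i j; fin_cases i <;> fin_cases j <;> simp [aMat, pow_add, pow_two]

theorem cyclic_comm {G : Type*} [Group G] (h : IsCyclic G) (x y : G) : x * y = y * x := by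
  let _ := h.commGroup
  exact mul_comm x y

theorem rel_one (z c : ℂ) (hz0 : z ≠ 0) (hc0 : c ≠ 0) :
    (aMat c hc0)⁻¹ * hMat z hz0 * aMat c hc0 * hMat z hz0 = 1 := by
  rw [mul_assoc, mul_assoc, inv_mul_eq_one]
  apply Units.ext
  ext i j
  fin_cases i <;> fin_cases j <;> simp [aMat, hMat]
  · field_simp
  · field_simp

theorem rel_two (z c : ℂ) (hz0 : z ≠ 0) (hc0 : c ≠ 0) (n β : ℕ)
    (hw : (z ^ β)⁻¹ = z ^ β) (hc : c ^ (2 * n) = z ^ β) :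
    aMat c hc0 ^ (2 * n) = hMat z hz0 ^ β := by
  apply Units.ext
  rw [aMat_pow, hMat_pow, hw, hc]

theorem not_comm (z c : ℂ) (hz0 : z ≠ 0) (hc0 : c ≠ 0) (hz2 : z ^ 2 ≠ 1)
    (h : aMat c hc0 * hMat z hz0 = hMat z hz0 * aMat c hc0) : False := by
  have h0 := Units.ext_iff.mp h
  rw [Units.val_mul, Units.val_mul] at h0
  have h1 := congrFun (congrFun h0 0) 1
  simp [aMat, hMat] at h1
  apply hz2
  field_simp at h1
  grind

theorem image_comm {H : Type*} [Group H] (n β : ℕ)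
    (hcomm : ∀ x y : PresentedGroup (Grels n β), x * y = y * x) (u v : H)
    (h1 : u⁻¹ * v * u * v = 1) (h2 : u ^ (2 * n) = v ^ β) : u * v = v * u := by
  have hf : ∀ r ∈ Grels n β, FreeGroup.lift ![u, v] r = 1 := by
    intro r hr
    rcases hr with rfl | rfl
    · simpa using h1
    · simp [h2]
  have h := congrArg (PresentedGroup.toGroup hf)
    (hcomm (PresentedGroup.of 0) (PresentedGroup.of 1))
  simp only [map_mul, PresentedGroup.toGroup.of] at h
  exact h

/-- For `β ≥ 2` the group `G(n,β)` is not cyclic, indeed not abelian. -/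
theorem G_not_cyclic_of_two_le_beta (n β : ℕ) (hn : 1 ≤ n) (hβ : 2 ≤ β) :
    ¬ IsCyclic (PresentedGroup (Grels n β)) ∧
    ¬ ∀ x y : PresentedGroup (Grels n β), x * y = y * x := by
  have key : ¬ ∀ x y : PresentedGroup (Grels n β), x * y = y * x := by
    intro hcomm
    obtain ⟨z, hz⟩ : ∃ z : ℂ, IsPrimitiveRoot z (2 * β) :=
      ⟨_, Complex.isPrimitiveRoot_exp (2 * β) (by omega)⟩
    have hz0 : z ≠ 0 := hz.ne_zero (by omega)
    have hz2 : z ^ 2 ≠ 1 := hz.pow_ne_one_of_pos_of_lt (by omega) (by omega)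
    have hw : (z ^ β)⁻¹ = z ^ β := by
      apply inv_eq_of_mul_eq_one_left
      rw [← pow_add, ← two_mul]
      exact hz.pow_eq_one
    obtain ⟨c, hc⟩ := IsAlgClosed.exists_pow_nat_eq (z ^ β) (n := 2 * n) (by omega)
    have hc0 : c ≠ 0 := by
      rintro rfl
      rw [zero_pow (by omega)] at hc
      exact pow_ne_zero β hz0 hc.symm
    exact not_comm z c hz0 hc0 hz2 (image_comm n β hcomm _ _ (rel_one z c hz0 hc0)
      (rel_two z c hz0 hc0 n β hw hc))
  exact ⟨fun hcyc => key (cyclic_comm hcyc), key⟩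
end

section
/- Let n ≥ 1 be an integer, s = sin(π/(2n)), c = cos(π/(2n)), and let ι : ℂ² → ℍ be the ℝ-linear identification ι(z₁, z₂) = Re(z₁) + Im(z₁)·i + Re(z₂)·j + Im(z₂)·k (i.e. z₁ + z₂·j). Then for all (z₁, z₂) ∈ ℂ²: (1) ι(e^{πi/(2n)} \overline{z₂}, e^{−πi/(2n)} \overline{z₁}) = −s·k·ι(z₁,z₂) + c·k·ι(z₁,z₂)·i, and (2) ι(e^{πi/(2n)} z₁, e^{πi(2n−1)/(2n)} z₂) = s·i·ι(z₁,z₂) − c·i·ι(z₁,z₂)·i. That is, under the identification ℂ² ≅ ℍ, the maps A₊(z₁,z₂) = (e^{πi/(2n)} \overline{z₂}, e^{−πi/(2n)} \overline{z₁}) and A_{2n−1}(z₁,z₂) = (e^{πi/(2n)} z₁, e^{πi(2n−1)/(2n)} z₂) take the stated quaternionic forms. -/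
open Complex
open scoped Quaternion

/-- Under the identification `ι : ℂ² ≅ ℍ`, `ι(z₁,z₂) = z₁ + z₂·j`, the maps
`A₊(z₁,z₂) = (e^{πi/2n} z̄₂, e^{−πi/2n} z̄₁)` and
`A_{2n−1}(z₁,z₂) = (e^{πi/2n} z₁, e^{πi(2n−1)/2n} z₂)` take the quaternionic forms
`a ↦ −s·k·a + c·k·a·i` and `a ↦ s·i·a − c·i·a·i` respectively, where
`s = sin(π/2n)`, `c = cos(π/2n)`. -/
theorem quaternionic_forms (n : ℕ) (hn : 1 ≤ n) (s c : ℝ) (qi qk : ℍ[ℝ])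
    (hs : s = Real.sin (Real.pi / (2 * n))) (hc : c = Real.cos (Real.pi / (2 * n)))
    (hqi : qi = (⟨0, 1, 0, 0⟩ : ℍ[ℝ])) (hqk : qk = (⟨0, 0, 0, 1⟩ : ℍ[ℝ]))
    (ι : ℂ × ℂ → ℍ[ℝ])
    (hι : ∀ z : ℂ × ℂ, ι z = (⟨z.1.re, z.1.im, z.2.re, z.2.im⟩ : ℍ[ℝ])) :
    ∀ z : ℂ × ℂ,
      ι (Complex.exp (Real.pi * I / (2 * n)) * (starRingEnd ℂ) z.2,
         Complex.exp (-(Real.pi * I / (2 * n))) * (starRingEnd ℂ) z.1) =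
        -(s • (qk * ι z)) + c • (qk * ι z * qi) ∧
      ι (Complex.exp (Real.pi * I / (2 * n)) * z.1,
         Complex.exp (Real.pi * I * (2 * n - 1) / (2 * n)) * z.2) =
        s • (qi * ι z) - c • (qi * ι z * qi) := by
  have hn0 : (n : ℂ) ≠ 0 := by
    have : n ≠ 0 := by omega
    exact_mod_cast this
  have e1 : Complex.exp (Real.pi * I / (2 * n)) = (⟨c, s⟩ : ℂ) := by
    have h : (Real.pi * I / (2 * n) : ℂ) = ((Real.pi / (2 * n) : ℝ) : ℂ) * I := by
      push_cast; ring
    rw [h, hs, hc]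
    apply Complex.ext
    · exact Complex.exp_ofReal_mul_I_re _
    · exact Complex.exp_ofReal_mul_I_im _
  have e2 : Complex.exp (-(Real.pi * I / (2 * n))) = (⟨c, -s⟩ : ℂ) := by
    have h : (-(Real.pi * I / (2 * n)) : ℂ) = ((-(Real.pi / (2 * n)) : ℝ) : ℂ) * I := by
      push_cast; ring
    rw [h, hs, hc, ← Real.sin_neg, ← Real.cos_neg]
    apply Complex.ext
    · exact Complex.exp_ofReal_mul_I_re _
    · exact Complex.exp_ofReal_mul_I_im _
  have e3 : Complex.exp (Real.pi * I * (2 * n - 1) / (2 * n)) = (⟨-c, s⟩ : ℂ) := by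
    have h : (Real.pi * I * (2 * n - 1) / (2 * n) : ℂ)
        = Real.pi * I + -(Real.pi * I / (2 * n)) := by
      field_simp
      ring
    rw [h, Complex.exp_add, Complex.exp_pi_mul_I, e2]
    apply Complex.ext <;> simp
  intro z
  have i0 : qi.re = 0 := by rw [hqi]
  have i1 : qi.imI = 1 := by rw [hqi]
  have i2 : qi.imJ = 0 := by rw [hqi]
  have i3 : qi.imK = 0 := by rw [hqi]
  have k0 : qk.re = 0 := by rw [hqk]
  have k1 : qk.imI = 0 := by rw [hqk]
  have k2 : qk.imJ = 0 := by rw [hqk]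
  have k3 : qk.imK = 1 := by rw [hqk]
  have r0 (w : ℂ × ℂ) : (ι w).re = w.1.re := by rw [hι]
  have r1 (w : ℂ × ℂ) : (ι w).imI = w.1.im := by rw [hι]
  have r2 (w : ℂ × ℂ) : (ι w).imJ = w.2.re := by rw [hι]
  have r3 (w : ℂ × ℂ) : (ι w).imK = w.2.im := by rw [hι]
  rw [e1, e2, e3]
  clear hι hqi hqk
  constructor
  · ext <;> simp [i0, i1, i2, i3, k0, k1, k2, k3, r0, r1, r2, r3] <;> ring
  · ext <;> simp [i0, i1, i2, i3, k0, k1, k2, k3, r0, r1, r2, r3] <;> ring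
end
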